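/- Let ν ∈ ℕ, H₁,…,H_ν ∈ ℝ with H₁ ≠ 0, let x̄₀ ∈ 𝕋, and let γ̄₁,…,γ̄_ν ∈ 𝕋 satisfy γ̄_i ≠ γ̄₁ for all i = 2,…,ν. Define g : [0,1] → ℝ by g(x) = (Σ_{i=1}^{ν} H_i)·(∫₀^x ι(y + x̄₀) dy − x/2) + Σ_{i=1}^{ν} H_i·(∫₀^x 𝟙_{[0,γ̄_i]}(y + x̄₀) dy − x·ι(γ̄_i)). Then g(0) = g(1) = 0, g is continuous on [0,1], and g is not constant on [0,1]. -/

import Mathlib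

open MeasureTheory Filter Set Topology

noncomputable def toCircle (x : ℝ) : UnitAddCircle := x

/-- The canonical embedding `ι : 𝕋 → [0,1) ⊆ ℝ`. -/
noncomputable def iota (x : UnitAddCircle) : ℝ := (AddCircle.equivIco 1 0 x : ℝ)

/-- The limiting profile function
`g(x) = (∑ H_i)(∫₀^x ι(y + x̄₀) dy - x/2) + ∑ H_i (∫₀^x 𝟙_{[0,γ̄_i]}(y + x̄₀) dy - x ι(γ̄_i))`. -/
noncomputable def limitProfile {ν : ℕ} (H : Fin ν → ℝ) (xbar : UnitAddCircle)
    (gbar : Fin ν → UnitAddCircle) (x : ℝ) : ℝ :=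
  (∑ i, H i) * ((∫ y in (0:ℝ)..x, iota (toCircle y + xbar)) - x / 2)
    + ∑ i, H i * ((∫ y in (0:ℝ)..x,
        (if iota (toCircle y + xbar) ≤ iota (gbar i) then (1 : ℝ) else 0))
      - x * iota (gbar i))

theorem intervalIntegrable_of_norm_le {f : ℝ → ℝ} (hf : Measurable f) (C : ℝ)
    (hC : ∀ y, ‖f y‖ ≤ C) (a b : ℝ) : IntervalIntegrable f volume a b :=
  (intervalIntegrable_const (c := C)).mono_fun hf.aestronglyMeasurable
    (Eventually.of_forall fun y => (hC y).trans (le_abs_self C))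

theorem iota_coe (t : ℝ) : iota (t : UnitAddCircle) = Int.fract t := by
  have h := AddCircle.coe_equivIco_mk_apply (p := (1 : ℝ)) t
  rw [div_one, mul_one] at h
  exact h

theorem iota_mem_Ico (z : UnitAddCircle) : iota z ∈ Ico (0 : ℝ) 1 := by
  simpa [iota] using (AddCircle.equivIco 1 0 z).2

theorem coe_iota (z : UnitAddCircle) : ((iota z : ℝ) : UnitAddCircle) = z :=
  (AddCircle.equivIco 1 0).symm_apply_apply z

theorem iota_toCircle_add (y : ℝ) (z : UnitAddCircle) :
    iota (toCircle y + z) = Int.fract (y + iota z) := by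
  conv_lhs => rw [← coe_iota z, toCircle, ← AddCircle.coe_add, iota_coe]

/-- The balanced sawtooth `t ↦ 1/2 - {t}`. -/
noncomputable def sawtooth (t : ℝ) : ℝ := 1 / 2 - Int.fract t

theorem measurable_sawtooth : Measurable sawtooth :=
  measurable_const.sub measurable_fract

theorem norm_sawtooth_le (t : ℝ) : ‖sawtooth t‖ ≤ 1 := by
  have h0 := Int.fract_nonneg t
  have h1 := Int.fract_lt_one t
  rw [Real.norm_eq_abs, abs_le, sawtooth]
  constructor <;> linarith

theorem intervalIntegrable_sawtooth_sub (c a b : ℝ) :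
    IntervalIntegrable (fun y => sawtooth (c - y)) volume a b :=
  intervalIntegrable_of_norm_le (measurable_sawtooth.comp (measurable_const.sub measurable_id)) 1
    (fun _ => norm_sawtooth_le _) a b

theorem sawtooth_periodic : Function.Periodic sawtooth 1 := fun t => by
  simp [sawtooth, Int.fract_add_one]

theorem sawtooth_sub_fract (a t : ℝ) : sawtooth (a - Int.fract t) = sawtooth (a - t) := by
  have h : a - Int.fract t = a - t + (⌊t⌋ : ℝ) := by rw [Int.fract]; ring
  rw [h, sawtooth, sawtooth, Int.fract_add_intCast]

theorem integral_sawtooth_sub (c : ℝ) : ∫ y in (0 : ℝ)..1, sawtooth (c - y) = 0 := by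
  rw [intervalIntegral.integral_comp_sub_left]
  have h := sawtooth_periodic.intervalIntegral_add_eq (c - 1) 0
  rw [sub_add_cancel, zero_add] at h
  rw [sub_zero, h]
  have h' : ∫ y in (0 : ℝ)..1, sawtooth y = ∫ y in (0 : ℝ)..1, (1 / 2 - y) := by
    refine intervalIntegral.integral_congr_Ioo_of_le zero_le_one fun y hy => ?_
    simp [sawtooth, Int.fract_eq_self.2 ⟨hy.1.le, hy.2⟩]
  rw [h', intervalIntegral.integral_sub (by simp) (by simp)]
  norm_num

/-- The jumps of `t ↦ t` and of the indicator of `[0, γ]` at `0` cancel on the circle. -/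
theorem sawtooth_sub_eq {γ t : ℝ} (hγ : γ ∈ Ico (0 : ℝ) 1) (ht : t ∈ Ico (0 : ℝ) 1) :
    sawtooth (γ - t) = (t - 1 / 2) + ((if t ≤ γ then 1 else 0) - γ) := by
  obtain ⟨hγ0, hγ1⟩ := hγ
  obtain ⟨ht0, ht1⟩ := ht
  split_ifs with h
  · rw [sawtooth, Int.fract_eq_self.2 ⟨by linarith, by linarith⟩]; ring
  · have h' : Int.fract (γ - t) = γ - t + 1 :=
      Int.fract_eq_iff.2 ⟨by linarith, by linarith [not_le.1 h], -1, by push_cast; ring⟩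
    rw [sawtooth, h']; ring

theorem limitProfile_eq_integral {ν : ℕ} (H : Fin ν → ℝ) (xbar : UnitAddCircle)
    (gbar : Fin ν → UnitAddCircle) (x : ℝ) :
    limitProfile H xbar gbar x =
      ∫ y in (0 : ℝ)..x, ∑ i, H i * sawtooth (iota (gbar i) - iota xbar - y) := by
  have hm : Measurable fun y : ℝ => Int.fract (y + iota xbar) :=
    (measurable_id.add_const _).fract
  have hi1 : IntervalIntegrable (fun y : ℝ => Int.fract (y + iota xbar)) volume 0 x :=
    intervalIntegrable_of_norm_le hm 1 (fun y => by
      rw [Real.norm_of_nonneg (Int.fract_nonneg _)]; exact (Int.fract_lt_one _).le) _ _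
  have hi2 (γ : ℝ) : IntervalIntegrable
      (fun y : ℝ => if Int.fract (y + iota xbar) ≤ γ then (1 : ℝ) else 0) volume 0 x :=
    intervalIntegrable_of_norm_le
      (Measurable.ite (measurableSet_le hm measurable_const) measurable_const measurable_const) 1
      (fun y => by split_ifs <;> simp) _ _
  have key (i : Fin ν) : ∫ y in (0 : ℝ)..x, sawtooth (iota (gbar i) - iota xbar - y) =
      ((∫ y in (0 : ℝ)..x, Int.fract (y + iota xbar)) - x / 2) +
      ((∫ y in (0 : ℝ)..x, if Int.fract (y + iota xbar) ≤ iota (gbar i) then (1 : ℝ) else 0)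
        - x * iota (gbar i)) := by
    have h (y : ℝ) : sawtooth (iota (gbar i) - iota xbar - y) =
        (Int.fract (y + iota xbar) - 1 / 2) +
        ((if Int.fract (y + iota xbar) ≤ iota (gbar i) then 1 else 0) - iota (gbar i)) := by
      rw [← sawtooth_sub_eq (iota_mem_Ico _) ⟨Int.fract_nonneg _, Int.fract_lt_one _⟩,
        sawtooth_sub_fract]
      congr 1; ring
    simp_rw [h]
    rw [intervalIntegral.integral_add (hi1.sub intervalIntegrable_const)
        ((hi2 _).sub intervalIntegrable_const),
      intervalIntegral.integral_sub hi1 intervalIntegrable_const,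
      intervalIntegral.integral_sub (hi2 _) intervalIntegrable_const]
    simp
    ring
  rw [intervalIntegral.integral_finsetSum fun i _ =>
    (intervalIntegrable_sawtooth_sub _ _ _).const_mul _]
  simp_rw [intervalIntegral.integral_const_mul, key, limitProfile, iota_toCircle_add,
    Finset.sum_mul, ← Finset.sum_add_distrib, mul_add]

theorem continuousAt_sawtooth_sub {a b : UnitAddCircle} (h : a ≠ b) (s : ℝ) :
    ContinuousAt (fun y => sawtooth (iota a - s - y)) (iota b - s) := by
  have hne : iota a - s - (iota b - s) ≠ ⌊iota a - s - (iota b - s)⌋ := fun hr => h <| by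
    rw [sub_sub_sub_cancel_right] at hr
    rw [← coe_iota a, ← coe_iota b, ← sub_eq_zero, ← AddCircle.coe_sub, AddCircle.coe_eq_zero_iff]
    exact ⟨_, by rw [zsmul_one]; exact hr.symm⟩
  have hf := continuousAt_fract hne
  exact continuousAt_const.sub
    (ContinuousAt.comp hf (continuousAt_const.sub continuousAt_id))

theorem tendsto_sawtooth_sub_left (c : ℝ) :
    Tendsto (fun y => sawtooth (c - y)) (𝓝[≤] c) (𝓝 (1 / 2)) := by
  have hsub : Tendsto (fun y => c - y) (𝓝[≤] c) (𝓝[≥] 0) :=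
    tendsto_nhdsWithin_iff.2
      ⟨((continuous_const.sub continuous_id).tendsto' c 0 (sub_self c)).mono_left
        nhdsWithin_le_nhds, eventually_mem_nhdsWithin.mono fun y hy => mem_Ici.2 (sub_nonneg.2 hy)⟩
  have hfract : Tendsto (Int.fract : ℝ → ℝ) (𝓝[≥] 0) (𝓝 0) := by
    simpa using tendsto_fract_right' (α := ℝ) 0
  have h := (hfract.comp hsub).const_sub (1 / 2)
  rwa [sub_zero] at h

theorem tendsto_sawtooth_sub_right (c : ℝ) :
    Tendsto (fun y => sawtooth (c - y)) (𝓝[>] c) (𝓝 (-(1 / 2))) := by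
  have hsub : Tendsto (fun y => c - y) (𝓝[>] c) (𝓝[<] 0) :=
    tendsto_nhdsWithin_iff.2
      ⟨((continuous_const.sub continuous_id).tendsto' c 0 (sub_self c)).mono_left
        nhdsWithin_le_nhds, eventually_mem_nhdsWithin.mono fun y hy => mem_Iio.2 (sub_neg.2 hy)⟩
  have hfract : Tendsto (Int.fract : ℝ → ℝ) (𝓝[<] 0) (𝓝 1) := by
    simpa using tendsto_fract_left' (α := ℝ) 0
  have h := (hfract.comp hsub).const_sub (1 / 2)
  rwa [show (1 / 2 - 1 : ℝ) = -(1 / 2) by norm_num] at h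

theorem eq_zero_of_tendsto_of_integral_eq_zero {f : ℝ → ℝ} (hf : Measurable f)
    (hint : ∀ a b, IntervalIntegrable f volume a b) (h0 : ∀ x, ∫ y in (0 : ℝ)..x, f y = 0)
    {c l : ℝ} {s t : Set ℝ} [intervalIntegral.FTCFilter c (𝓝[s] c) (𝓝[t] c)]
    (hs : UniqueDiffWithinAt ℝ s c) (hl : Tendsto f (𝓝[t] c) (𝓝 l)) : l = 0 := by
  have h := intervalIntegral.integral_hasDerivWithinAt_of_tendsto_ae_right (s := s) (hint 0 c)
    hf.stronglyMeasurable.stronglyMeasurableAtFilter (hl.mono_left inf_le_left)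
  simp_rw [h0] at h
  exact hs.eq_deriv _ h (hasDerivWithinAt_const c s 0)

/-- The profile `g` satisfies `g(0) = g(1) = 0`, is continuous on `[0,1]` and is not
constant on `[0,1]`, provided `H₁ ≠ 0` and `γ̄_i ≠ γ̄₁` for `i ≠ 1`. -/
theorem limitProfile_nonconstant (ν : ℕ) (hν : 0 < ν) (H : Fin ν → ℝ)
    (hH : H ⟨0, hν⟩ ≠ 0) (xbar : UnitAddCircle) (gbar : Fin ν → UnitAddCircle)
    (hgbar : ∀ i, i ≠ ⟨0, hν⟩ → gbar i ≠ gbar ⟨0, hν⟩) :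
    limitProfile H xbar gbar 0 = 0 ∧ limitProfile H xbar gbar 1 = 0 ∧
    ContinuousOn (limitProfile H xbar gbar) (Set.Icc 0 1) ∧
    ∃ x ∈ Set.Icc (0:ℝ) 1, ∃ y ∈ Set.Icc (0:ℝ) 1,
      limitProfile H xbar gbar x ≠ limitProfile H xbar gbar y := by
  set c : Fin ν → ℝ := fun i => iota (gbar i) - iota xbar
  set F : ℝ → ℝ := fun y => ∑ i, H i * sawtooth (c i - y) with hF
  have hG : limitProfile H xbar gbar = fun x => ∫ y in (0 : ℝ)..x, F y :=
    funext (limitProfile_eq_integral H xbar gbar)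
  have hmeas : Measurable F := Finset.measurable_fun_sum _ fun i _ =>
    (measurable_sawtooth.comp (measurable_const.sub measurable_id)).const_mul _
  have hint (a b : ℝ) : IntervalIntegrable F volume a b := by
    have := IntervalIntegrable.sum Finset.univ (μ := volume) (a := a) (b := b)
      (f := fun i y => H i * sawtooth (c i - y))
      fun i _ => (intervalIntegrable_sawtooth_sub (c i) a b).const_mul (H i)
    rwa [Finset.sum_fn] at this
  have hper : Function.Periodic F 1 := fun y => by
    simp_rw [hF, ← sub_sub, sawtooth_periodic.sub_eq]
  have hG1 : ∫ y in (0 : ℝ)..1, F y = 0 := by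
    rw [intervalIntegral.integral_finsetSum fun i _ =>
      (intervalIntegrable_sawtooth_sub _ _ _).const_mul _]
    simp_rw [intervalIntegral.integral_const_mul, integral_sawtooth_sub, mul_zero,
      Finset.sum_const_zero]
  rw [hG]
  refine ⟨intervalIntegral.integral_same, hG1,
    (intervalIntegral.continuous_primitive hint 0).continuousOn, ?_⟩
  by_contra! hcon
  have hGper : Function.Periodic (fun x => ∫ y in (0 : ℝ)..x, F y) 1 := fun x => by
    have := hper.intervalIntegral_add_eq_add 0 x hint
    rwa [zero_add, hG1, add_zero] at this
  have h0 (x : ℝ) : ∫ y in (0 : ℝ)..x, F y = 0 := by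
    obtain ⟨y, hy, hxy⟩ := hGper.exists_mem_Ico₀ zero_lt_one x
    exact hxy.trans ((hcon y ⟨hy.1, hy.2.le⟩ 1 (by simp)).trans hG1)
  set k : Fin ν := ⟨0, hν⟩
  set R : ℝ → ℝ := fun y => ∑ i ∈ Finset.univ.erase k, H i * sawtooth (c i - y)
  have hFR : F = fun y => H k * sawtooth (c k - y) + R y := funext fun y =>
    (Finset.add_sum_erase _ (fun i => H i * sawtooth (c i - y)) (Finset.mem_univ k)).symm
  have hR : Tendsto R (𝓝 (c k)) (𝓝 (R (c k))) := tendsto_finsetSum _ fun i hi =>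
    (continuousAt_sawtooth_sub (hgbar i (Finset.ne_of_mem_erase hi)) _).tendsto.const_mul _
  have hleft : Tendsto F (𝓝[≤] c k) (𝓝 (H k * (1 / 2) + R (c k))) := by
    rw [hFR]
    exact ((tendsto_sawtooth_sub_left _).const_mul _).add (hR.mono_left nhdsWithin_le_nhds)
  have hright : Tendsto F (𝓝[>] c k) (𝓝 (H k * -(1 / 2) + R (c k))) := by
    rw [hFR]
    exact ((tendsto_sawtooth_sub_right _).const_mul _).add (hR.mono_left nhdsWithin_le_nhds)
  have hl := eq_zero_of_tendsto_of_integral_eq_zero hmeas hint h0 (s := Iic (c k))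
    (uniqueDiffWithinAt_Iic _) hleft
  have hr := eq_zero_of_tendsto_of_integral_eq_zero hmeas hint h0 (s := Ici (c k))
    (uniqueDiffWithinAt_Ici _) hright
  exact hH (by linarith)
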